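/- arXiv:1101.3420 — 4 statements merged into one kernel-verified Lean document; each statement's English description precedes it below -/
import Mathlib

section
/- Let ρ satisfy properties (i)–(iii) of Hypothesis 2.4. Every ρ-basic class [x]_ρ that is closed and contained in M_1 is F-invariant: F([x]_ρ) = [x]_ρ. -/
open MeasureTheory ProbabilityTheory Metric Set Filter Topology
open scoped ENNReal NNReal

noncomputable section

namespace QSDPaper

variable {d : ℕ}

/-- An absorption-preserving (ap) `δ`-pseudoorbit `ξ_0, …, ξ_n` in `M`. -/
def IsApOrbit (F : (Fin d → ℝ) → Fin d → ℝ) (M M0 : Set (Fin d → ℝ)) (δ : ℝ)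
    (n : ℕ) (ξ : ℕ → Fin d → ℝ) : Prop :=
  1 ≤ n ∧ (∀ i ≤ n, ξ i ∈ M) ∧ (∀ i < n, ξ i ∈ M0 → ξ (i + 1) ∈ M0) ∧
    ∀ i < n, dist (ξ (i + 1)) (F (ξ i)) < δ

/-- `x <_ap y`: for every `δ > 0` there is an ap `δ`-pseudoorbit joining `x` to `y`. -/
def apLe (F : (Fin d → ℝ) → Fin d → ℝ) (M M0 : Set (Fin d → ℝ)) (x y : Fin d → ℝ) : Prop :=
  ∀ δ > (0 : ℝ), ∃ n ξ, IsApOrbit F M M0 δ n ξ ∧ ξ 0 = x ∧ ξ n = y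

/-- `x ∼_ap y`. -/
def apEquiv (F : (Fin d → ℝ) → Fin d → ℝ) (M M0 : Set (Fin d → ℝ)) (x y : Fin d → ℝ) : Prop :=
  apLe F M M0 x y ∧ apLe F M M0 y x

/-- The set `R_ap` of ap-chain recurrent points. -/
def apRec (F : (Fin d → ℝ) → Fin d → ℝ) (M M0 : Set (Fin d → ℝ)) : Set (Fin d → ℝ) :=
  {x | apEquiv F M M0 x x}

/-- The ap-basic class of `x`. -/
def apClass (F : (Fin d → ℝ) → Fin d → ℝ) (M M0 : Set (Fin d → ℝ)) (x : Fin d → ℝ) :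
    Set (Fin d → ℝ) :=
  {y | y ∈ apRec F M M0 ∧ apEquiv F M M0 x y}

/-- `[x]_ap` is a maximal ap-basic class. -/
def IsApQuasiattractor (F : (Fin d → ℝ) → Fin d → ℝ) (M M0 : Set (Fin d → ℝ))
    (x : Fin d → ℝ) : Prop :=
  x ∈ apRec F M M0 ∧ ∀ y ∈ apRec F M M0, apLe F M M0 x y → apEquiv F M M0 x y

/-- A compact set `A` is an attractor for `F : M → M`. -/
def IsAttractor (F : (Fin d → ℝ) → Fin d → ℝ) (M A : Set (Fin d → ℝ)) : Prop :=
  IsCompact A ∧ A ⊆ M ∧ ∃ U : Set (Fin d → ℝ), IsOpen U ∧ A ⊆ U ∧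
    (⋂ n ∈ {k : ℕ | 1 ≤ k}, F^[n] '' (U ∩ M)) = A ∧
    ∀ V : Set (Fin d → ℝ), IsOpen V → A ⊆ V → ∃ N : ℕ, ∀ n ≥ N, F^[n] '' (U ∩ M) ⊆ V

/-- The ω-limit set of `x` under `F`. -/
def omegaSet (F : (Fin d → ℝ) → Fin d → ℝ) (x : Fin d → ℝ) : Set (Fin d → ℝ) :=
  {y | ∃ φ : ℕ → ℕ, StrictMono φ ∧ Tendsto (fun k => F^[φ k] x) atTop (𝓝 y)}

/-- The nonwandering set of `F` on `M`. -/
def nonwanderingSet (F : (Fin d → ℝ) → Fin d → ℝ) (M : Set (Fin d → ℝ)) :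
    Set (Fin d → ℝ) :=
  {x ∈ M | ∀ U : Set (Fin d → ℝ), IsOpen U → x ∈ U → ∀ N : ℕ,
    ∃ n ≥ N, ((F^[n] '' (U ∩ M)) ∩ (U ∩ M)).Nonempty}

/-- `β_δ(ε) = sup_{x ∈ M} p^ε(x, M \ N^δ(F x))`. -/
def beta (p : ℝ → Kernel (Fin d → ℝ) (Fin d → ℝ)) (F : (Fin d → ℝ) → Fin d → ℝ)
    (M : Set (Fin d → ℝ)) (δ ε : ℝ) : ℝ≥0∞ :=
  ⨆ x ∈ M, p ε x (M \ ball (F x) δ)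

/-- `μ` is a quasi-stationary distribution for `κ` on `M1` with eigenvalue `lam ∈ (0,1)`. -/
def IsQSD (κ : Kernel (Fin d → ℝ) (Fin d → ℝ)) (M1 : Set (Fin d → ℝ))
    (μ : Measure (Fin d → ℝ)) (lam : ℝ) : Prop :=
  IsProbabilityMeasure μ ∧ μ M1 = 1 ∧ 0 < lam ∧ lam < 1 ∧
    ∀ Γ : Set (Fin d → ℝ), MeasurableSet Γ → Γ ⊆ M1 →
      ∫⁻ x in M1, κ x Γ ∂μ = ENNReal.ofReal lam * μ Γ

/-- Weak* convergence of a sequence of measures (tested against bounded continuous functions). -/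
def WeaklyTendsto (μs : ℕ → Measure (Fin d → ℝ)) (μ : Measure (Fin d → ℝ)) : Prop :=
  ∀ g : BoundedContinuousFunction (Fin d → ℝ) ℝ,
    Tendsto (fun n => ∫ x, g x ∂μs n) atTop (𝓝 (∫ x, g x ∂μ))

/-- `stayProb κ V n x = P_x[X_0, …, X_n ∈ V] = P_x[τ_V > n]` for the Markov chain with
transition kernel `κ` started at `x`, where `τ_V = min {n : X_n ∉ V}`. -/
def stayProb (κ : Kernel (Fin d → ℝ) (Fin d → ℝ)) (V : Set (Fin d → ℝ)) :
    ℕ → (Fin d → ℝ) → ℝ≥0∞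
  | 0, x => V.indicator 1 x
  | n + 1, x => V.indicator (fun z => ∫⁻ y, stayProb κ V n y ∂κ z) x

/-- `tubeProb κ η n ξ x = P_x[dist (X_j, ξ_j) < η for j = 1, …, n]` for the Markov chain
with transition kernel `κ` started at `x`. -/
def tubeProb (κ : Kernel (Fin d → ℝ) (Fin d → ℝ)) (η : ℝ) :
    ℕ → (ℕ → Fin d → ℝ) → (Fin d → ℝ) → ℝ≥0∞
  | 0, _, _ => 1
  | n + 1, ξ, x => ∫⁻ y in ball (ξ 1) η, tubeProb κ η n (fun k => ξ (k + 1)) y ∂κ x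

/-- `A_n(ξ) = Σ_{i<n} ρ(ξ_i, ξ_{i+1})`. -/
def rhoCost (ρ : (Fin d → ℝ) → (Fin d → ℝ) → ℝ≥0∞) (n : ℕ) (ξ : ℕ → Fin d → ℝ) : ℝ≥0∞ :=
  ∑ i ∈ Finset.range n, ρ (ξ i) (ξ (i + 1))

/-- `B_ρ(x,y)`: minimal cost of a finite path in `M` from `x` to `y`. -/
def Brho (ρ : (Fin d → ℝ) → (Fin d → ℝ) → ℝ≥0∞) (M : Set (Fin d → ℝ))
    (x y : Fin d → ℝ) : ℝ≥0∞ :=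
  ⨅ (n : ℕ) (_ : 1 ≤ n) (ξ : ℕ → Fin d → ℝ)
    (_ : (∀ i ≤ n, ξ i ∈ M) ∧ ξ 0 = x ∧ ξ n = y), rhoCost ρ n ξ

/-- `x <_ρ y`. -/
def rhoLe (ρ : (Fin d → ℝ) → (Fin d → ℝ) → ℝ≥0∞) (M : Set (Fin d → ℝ))
    (x y : Fin d → ℝ) : Prop :=
  Brho ρ M x y = 0

/-- `x ∼_ρ y`. -/
def rhoEquiv (ρ : (Fin d → ℝ) → (Fin d → ℝ) → ℝ≥0∞) (M : Set (Fin d → ℝ))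
    (x y : Fin d → ℝ) : Prop :=
  rhoLe ρ M x y ∧ rhoLe ρ M y x

/-- The ρ-chain recurrent set `R_ρ`. -/
def rhoRec (ρ : (Fin d → ℝ) → (Fin d → ℝ) → ℝ≥0∞) (M : Set (Fin d → ℝ)) :
    Set (Fin d → ℝ) :=
  {x | rhoEquiv ρ M x x}

/-- The ρ-basic class of `x`. -/
def rhoClass (ρ : (Fin d → ℝ) → (Fin d → ℝ) → ℝ≥0∞) (M : Set (Fin d → ℝ))
    (x : Fin d → ℝ) : Set (Fin d → ℝ) :=
  {y | y ∈ rhoRec ρ M ∧ rhoEquiv ρ M x y}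

/-- `[x]_ρ` is a maximal ρ-basic class. -/
def IsRhoQuasiattractor (ρ : (Fin d → ℝ) → (Fin d → ℝ) → ℝ≥0∞) (M : Set (Fin d → ℝ))
    (x : Fin d → ℝ) : Prop :=
  x ∈ rhoRec ρ M ∧ ∀ y ∈ rhoRec ρ M, rhoLe ρ M x y → rhoEquiv ρ M x y

/-- Properties (i)–(iii) of Hypothesis 2.4 for the rate function `ρ`. -/
def HypRho (F : (Fin d → ℝ) → Fin d → ℝ) (M M0 : Set (Fin d → ℝ))
    (ρ : (Fin d → ℝ) → (Fin d → ℝ) → ℝ≥0∞) : Prop :=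
  ContinuousOn (fun q : (Fin d → ℝ) × (Fin d → ℝ) => ρ q.1 q.2) ((M \ M0) ×ˢ M) ∧
  (∀ x ∈ M, ∀ y ∈ M, (ρ x y = 0 ↔ y = F x)) ∧
  (∀ β : ℝ, 0 < β → ∃ c : ℝ≥0∞, 0 < c ∧ ∀ x ∈ M, ∀ y ∈ M, β < dist (F x) y → c ≤ ρ x y)

/-- Property (iv) of Hypothesis 2.4: large deviation upper and lower bounds. -/
def HypLD (p : ℝ → Kernel (Fin d → ℝ) (Fin d → ℝ)) (F : (Fin d → ℝ) → Fin d → ℝ)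
    (M M0 : Set (Fin d → ℝ)) (ρ : (Fin d → ℝ) → (Fin d → ℝ) → ℝ≥0∞) : Prop :=
  (∀ K : Set (Fin d → ℝ), IsCompact K → K ⊆ M \ M0 → ∀ z : Fin d → ℝ, ∀ r > (0 : ℝ),
    ∀ η > (0 : ℝ), ∀ᶠ ε : ℝ in 𝓝[>] (0 : ℝ), ∀ x ∈ K,
      -(((⨅ y ∈ ball z r ∩ M, ρ x y : ℝ≥0∞) : EReal)) - (η : EReal)
        ≤ (ε : EReal) * ENNReal.log (p ε x (ball z r ∩ M))) ∧
  (∀ C : Set (Fin d → ℝ), IsClosed C → C ⊆ M → ∀ η > (0 : ℝ),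
    ∀ᶠ ε : ℝ in 𝓝[>] (0 : ℝ), ∀ x ∈ M,
      (ε : EReal) * ENNReal.log (p ε x C) + ((⨅ y ∈ C, ρ x y : ℝ≥0∞) : EReal) ≤ (η : EReal))

/-- Hypothesis 2.5: absorption is not too unlikely near the absorbing set. -/
def HypAbs (p : ℝ → Kernel (Fin d → ℝ) (Fin d → ℝ)) (M M0 : Set (Fin d → ℝ)) : Prop :=
  ∀ c > (0 : ℝ), ∃ V0 : Set (Fin d → ℝ), IsOpen V0 ∧ M0 ⊆ V0 ∧
    (-(c : EReal)) ≤
      Filter.liminf (fun ε : ℝ => ⨅ x ∈ V0 ∩ M, (ε : EReal) * ENNReal.log (p ε x M0))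
        (𝓝[>] (0 : ℝ))

/-- The (topological) support of a measure. -/
def measSupport (μ : Measure (Fin d → ℝ)) : Set (Fin d → ℝ) :=
  {x | ∀ U : Set (Fin d → ℝ), IsOpen U → x ∈ U → 0 < μ U}

/-- There is a path of length `n` from `x` to `y` of cost `c`. -/
def PChain (ρ : (Fin d → ℝ) → (Fin d → ℝ) → ℝ≥0∞) (M : Set (Fin d → ℝ)) (n : ℕ)
    (x y : Fin d → ℝ) (c : ℝ≥0∞) : Prop :=
  ∃ ξ : ℕ → Fin d → ℝ, ((∀ i ≤ n, ξ i ∈ M) ∧ ξ 0 = x ∧ ξ n = y) ∧ rhoCost ρ n ξ = c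

section aux
variable {ρ : (Fin d → ℝ) → (Fin d → ℝ) → ℝ≥0∞} {M M0 : Set (Fin d → ℝ)}
  {F : (Fin d → ℝ) → Fin d → ℝ} {n m : ℕ} {x y z : Fin d → ℝ} {a b c : ℝ≥0∞}

theorem PChain.left_mem (h : PChain ρ M n x y c) : x ∈ M := by
  obtain ⟨ξ, ⟨h1, h2, h3⟩, h4⟩ := h
  exact h2 ▸ h1 0 (Nat.zero_le _)

theorem PChain.right_mem (h : PChain ρ M n x y c) : y ∈ M := by
  obtain ⟨ξ, ⟨h1, h2, h3⟩, h4⟩ := h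
  exact h3 ▸ h1 n le_rfl

theorem PChain.single (hx : x ∈ M) (hy : y ∈ M) : PChain ρ M 1 x y (ρ x y) := by
  refine ⟨fun i => if i = 0 then x else y, ⟨?_, by simp, by simp⟩, by simp [rhoCost]⟩
  intro i _
  by_cases h : i = 0 <;> simp [h, hx, hy]

theorem PChain.trans (h : PChain ρ M n x y a) (h' : PChain ρ M m y z b) :
    PChain ρ M (n + m) x z (a + b) := by
  obtain ⟨ξ, ⟨h1, h2, h3⟩, h4⟩ := h
  obtain ⟨η, ⟨k1, k2, k3⟩, k4⟩ := h'
  have key : ∀ i, (if n + i ≤ n then ξ (n + i) else η (n + i - n)) = η i := by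
    intro i
    by_cases hi : i = 0
    · subst hi; simp [h3, k2]
    · rw [if_neg (by omega)]; congr 1; omega
  refine ⟨fun i => if i ≤ n then ξ i else η (i - n), ⟨?_, by simp [h2], ?_⟩, ?_⟩
  · intro i hi
    by_cases h : i ≤ n
    · simp only [h, if_true]; exact h1 i h
    · simp only [h, if_false]; exact k1 _ (by omega)
  · simpa only [key] using k3
  · rw [rhoCost, Finset.sum_range_add, ← h4, ← k4]
    congr 1
    · refine Finset.sum_congr rfl fun i hi => ?_
      have := Finset.mem_range.1 hi
      simp only [show i ≤ n by omega, show i + 1 ≤ n by omega, if_true]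
    · refine Finset.sum_congr rfl fun i hi => ?_
      simp only [add_assoc, key]

theorem PChain.head (h : PChain ρ M (n + 1) x y c) :
    ∃ z b, PChain ρ M n z y b ∧ ρ x z + b = c := by
  obtain ⟨ξ, ⟨h1, h2, h3⟩, h4⟩ := h
  refine ⟨ξ 1, _, ⟨fun i => ξ (i + 1), ⟨fun i hi => h1 _ (by omega), rfl, h3⟩, rfl⟩, ?_⟩
  rw [← h4, rhoCost, rhoCost, Finset.sum_range_succ', h2, add_comm]

theorem PChain.tail (h : PChain ρ M (n + 1) x y c) :
    ∃ z b, PChain ρ M n x z b ∧ b + ρ z y = c := by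
  obtain ⟨ξ, ⟨h1, h2, h3⟩, h4⟩ := h
  refine ⟨ξ n, _, ⟨ξ, ⟨fun i hi => h1 _ (by omega), h2, rfl⟩, rfl⟩, ?_⟩
  rw [← h4, rhoCost, rhoCost, Finset.sum_range_succ, h3]

theorem rhoLe_iff : rhoLe ρ M x y ↔ ∀ ε : ℝ≥0∞, 0 < ε → ∃ n c, PChain ρ M (n + 1) x y c ∧ c < ε := by
  constructor
  · intro h ε hε
    have h' : Brho ρ M x y < ε := by rw [h]; exact hε
    simp only [Brho, iInf_lt_iff] at h'
    obtain ⟨n, hn, ξ, hξ, hc⟩ := h'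
    obtain ⟨n, rfl⟩ := Nat.exists_eq_add_of_le' hn
    exact ⟨n, _, ⟨ξ, hξ, rfl⟩, hc⟩
  · intro h
    rw [rhoLe, ← nonpos_iff_eq_zero]
    refine le_of_forall_gt fun ε hε => ?_
    obtain ⟨n, c, ⟨ξ, hξ, hc⟩, hlt⟩ := h ε hε
    simp only [Brho, iInf_lt_iff]
    exact ⟨n + 1, by omega, ξ, hξ, hc ▸ hlt⟩

theorem rhoLe.trans' (h : rhoLe ρ M x y) (h' : rhoLe ρ M y z) : rhoLe ρ M x z := by
  rw [rhoLe_iff] at *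
  intro ε hε
  obtain ⟨n, a, h1, h2⟩ := h (ε / 2) (ENNReal.half_pos hε.ne')
  obtain ⟨m, b, k1, k2⟩ := h' (ε / 2) (ENNReal.half_pos hε.ne')
  exact ⟨n + 1 + m, _, h1.trans k1, by rw [← ENNReal.add_halves ε]; exact ENNReal.add_lt_add h2 k2⟩

theorem rhoLe.long (h : rhoLe ρ M x x) (ε : ℝ≥0∞) (hε : 0 < ε) :
    ∃ n c, PChain ρ M (n + 3) x x c ∧ c < ε := by
  have hp : 0 < ε / 3 := ENNReal.div_pos hε.ne' (by simp)
  obtain ⟨n, a, h1, h2⟩ := rhoLe_iff.1 h (ε / 3) hp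
  refine ⟨n + n + n, a + a + a, ?_, ?_⟩
  · have := (h1.trans h1).trans h1
    rwa [show n + n + n + 3 = n + 1 + (n + 1) + (n + 1) by ring]
  · rw [← ENNReal.add_thirds ε]
    exact ENNReal.add_lt_add (ENNReal.add_lt_add h2 h2) h2

theorem HypRho.dist_tendsto (hρ : HypRho F M M0 ρ) {u v : ℕ → Fin d → ℝ}
    (hu : ∀ k, u k ∈ M) (hv : ∀ k, v k ∈ M)
    (h : Tendsto (fun k => ρ (u k) (v k)) atTop (𝓝 0)) :
    Tendsto (fun k => dist (F (u k)) (v k)) atTop (𝓝 0) := by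
  rw [Metric.tendsto_atTop]
  intro β hβ
  obtain ⟨c, hc, hcc⟩ := hρ.2.2 (β / 2) (by linarith)
  obtain ⟨N, hN⟩ := eventually_atTop.1 (h.eventually (gt_mem_nhds hc))
  refine ⟨N, fun k hk => ?_⟩
  rw [Real.dist_eq, sub_zero, abs_of_nonneg dist_nonneg]
  by_contra hcon
  exact absurd (hcc _ (hu k) _ (hv k) (by linarith)) (not_le.2 (hN k hk))

theorem HypRho.zero_tendsto (hρ : HypRho F M M0 ρ) {u v : ℕ → Fin d → ℝ}
    (hu : ∀ k, u k ∈ M) (hv : ∀ k, v k ∈ M) (hM0 : IsClosed M0)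
    (hx : x ∈ M \ M0) (hFx : F x ∈ M)
    (hux : Tendsto u atTop (𝓝 x)) (hvx : Tendsto v atTop (𝓝 (F x))) :
    Tendsto (fun k => ρ (u k) (v k)) atTop (𝓝 0) := by
  have h0 : ρ x (F x) = 0 := (hρ.2.1 x hx.1 _ hFx).2 rfl
  have hc := hρ.1 (x, F x) ⟨hx, hFx⟩
  rw [ContinuousWithinAt] at hc
  simp only [h0] at hc
  refine Tendsto.comp (g := fun q : (Fin d → ℝ) × (Fin d → ℝ) => ρ q.1 q.2)
    (f := fun k => (u k, v k)) hc ?_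
  refine tendsto_nhdsWithin_iff.2 ⟨hux.prodMk_nhds hvx, ?_⟩
  filter_upwards [hux.eventually (hM0.isOpen_compl.mem_nhds hx.2)] with k hk
  exact ⟨⟨hu k, hk⟩, hv k⟩

theorem cont_tendsto (hF : ContinuousOn F M) {u : ℕ → Fin d → ℝ} (hu : ∀ k, u k ∈ M)
    (hx : x ∈ M) (hux : Tendsto u atTop (𝓝 x)) :
    Tendsto (fun k => F (u k)) atTop (𝓝 (F x)) :=
  (hF x hx).tendsto.comp (tendsto_nhdsWithin_iff.2 ⟨hux, Eventually.of_forall hu⟩)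

theorem rho_forward (hFmap : MapsTo F M M) (hFcont : ContinuousOn F M) (hM0cl : IsClosed M0)
    (hFM1 : MapsTo F (M \ M0) (M \ M0)) (hρ : HypRho F M M0 ρ)
    (hy : y ∈ M \ M0) (h : rhoLe ρ M y y) : rhoLe ρ M (F y) y := by
  have H : ∀ k : ℕ, ∃ n z1 z2 b, PChain ρ M (n + 1) z2 y b ∧ z1 ∈ M ∧
      ρ y z1 ≤ (k : ℝ≥0∞)⁻¹ ∧ ρ z1 z2 ≤ (k : ℝ≥0∞)⁻¹ ∧ b ≤ (k : ℝ≥0∞)⁻¹ := by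
    intro k
    obtain ⟨n, c, h1, h2⟩ := h.long (k : ℝ≥0∞)⁻¹ (by simp)
    obtain ⟨z1, b1, h3, h4⟩ := h1.head
    obtain ⟨z2, b2, h5, h6⟩ := h3.head
    subst h6 h4
    exact ⟨n, z1, z2, b2, h5, h3.left_mem, le_self_add.trans h2.le,
      (le_self_add.trans le_add_self).trans h2.le, (le_add_self.trans le_add_self).trans h2.le⟩
  choose n z1 z2 b h1 h2 h3 h4 h5 using H
  have sq : ∀ f : ℕ → ℝ≥0∞, (∀ k, f k ≤ (k : ℝ≥0∞)⁻¹) → Tendsto f atTop (𝓝 0) := fun f hf =>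
    tendsto_of_tendsto_of_tendsto_of_le_of_le tendsto_const_nhds
      ENNReal.tendsto_inv_nat_nhds_zero (fun _ => zero_le) hf
  have hz2 : ∀ k, z2 k ∈ M := fun k => (h1 k).left_mem
  have t1 : Tendsto z1 atTop (𝓝 (F y)) :=
    tendsto_const_nhds.congr_dist (hρ.dist_tendsto (fun _ => hy.1) h2 (sq _ h3))
  have hFy := hFM1 hy
  have t2 : Tendsto z2 atTop (𝓝 (F (F y))) :=
    (cont_tendsto hFcont h2 hFy.1 t1).congr_dist (hρ.dist_tendsto h2 hz2 (sq _ h4))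
  have t3 : Tendsto (fun k => ρ (F y) (z2 k) + b k) atTop (𝓝 0) := by
    simpa using (hρ.zero_tendsto (fun _ => hFy.1) hz2 hM0cl hFy (hFmap hFy.1)
      tendsto_const_nhds t2).add (sq _ h5)
  rw [rhoLe_iff]
  intro ε hε
  obtain ⟨k, hk⟩ := (t3.eventually (gt_mem_nhds hε)).exists
  have := (PChain.single (ρ := ρ) hFy.1 (hz2 k)).trans (h1 k)
  rw [add_comm] at this
  exact ⟨_, _, this, hk⟩

theorem rho_backward (hMcl : IsClosed M) (hFmap : MapsTo F M M) (hFcont : ContinuousOn F M)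
    (hM0cl : IsClosed M0) (hFM0 : MapsTo F M0 M0) (hFbdd : ∃ C : ℝ, ∀ x ∈ M, ‖F x‖ ≤ C)
    (hρ : HypRho F M M0 ρ)
    (hy : y ∈ M \ M0) (h : rhoLe ρ M y y) : ∃ z ∈ M, F z = y ∧ rhoLe ρ M y z := by
  have H : ∀ k : ℕ, ∃ n v w z b, PChain ρ M (n + 1) y w b ∧ v ∈ M ∧ z ∈ M ∧
      ρ v w ≤ (k : ℝ≥0∞)⁻¹ ∧ ρ w z ≤ (k : ℝ≥0∞)⁻¹ ∧ ρ z y ≤ (k : ℝ≥0∞)⁻¹ ∧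
        b ≤ (k : ℝ≥0∞)⁻¹ := by
    intro k
    obtain ⟨n, c, h1, h2⟩ := h.long (k : ℝ≥0∞)⁻¹ (by simp)
    obtain ⟨z, b1, h3, h4⟩ := h1.tail
    obtain ⟨w, b2, h5, h6⟩ := h3.tail
    obtain ⟨v, b3, h7, h8⟩ := h5.tail
    have e2 : b2 ≤ (k : ℝ≥0∞)⁻¹ := by
      refine le_trans ?_ h2.le
      rw [← h4, ← h6, add_assoc]; exact le_self_add
    refine ⟨n, v, w, z, b2, h5, h7.right_mem, h3.right_mem, ?_, ?_, ?_, e2⟩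
    · refine le_trans ?_ e2
      rw [← h8]; exact le_add_self
    · refine le_trans ?_ h2.le
      rw [← h4, ← h6]; exact le_add_self.trans le_self_add
    · refine le_trans ?_ h2.le
      rw [← h4]; exact le_add_self
  choose n v w z b h1 h2 h3 h4 h5 h6 h7 using H
  have sq : ∀ f : ℕ → ℝ≥0∞, (∀ k, f k ≤ (k : ℝ≥0∞)⁻¹) → Tendsto f atTop (𝓝 0) := fun f hf =>
    tendsto_of_tendsto_of_tendsto_of_le_of_le tendsto_const_nhds
      ENNReal.tendsto_inv_nat_nhds_zero (fun _ => zero_le) hf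
  have hw : ∀ k, w k ∈ M := fun k => (h1 k).right_mem
  obtain ⟨C, hC⟩ := hFbdd
  obtain ⟨w₀, -, φ, hφ, t0⟩ := (isCompact_closedBall (0 : Fin d → ℝ) C).tendsto_subseq
    (x := fun k => F (v k)) (fun k => by simpa using hC _ (h2 k))
  have tφ := hφ.tendsto_atTop
  have t1 : Tendsto (fun k => w (φ k)) atTop (𝓝 w₀) :=
    Tendsto.congr_dist t0 ((hρ.dist_tendsto h2 hw (sq _ h4)).comp tφ)
  have hw0 : w₀ ∈ M := hMcl.mem_of_tendsto t1 (Eventually.of_forall fun k => hw _)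
  have t2 : Tendsto (fun k => z (φ k)) atTop (𝓝 (F w₀)) :=
    (cont_tendsto hFcont (fun k => hw (φ k)) hw0 t1).congr_dist
      ((hρ.dist_tendsto hw h3 (sq _ h5)).comp tφ)
  have t3 : Tendsto (fun _ : ℕ => y) atTop (𝓝 (F (F w₀))) :=
    (cont_tendsto hFcont (fun k => h3 (φ k)) (hFmap hw0) t2).congr_dist
      ((hρ.dist_tendsto h3 (fun _ => hy.1) (sq _ h6)).comp tφ)
  have hyF : F (F w₀) = y := tendsto_nhds_unique t3 tendsto_const_nhds
  have hw1 : w₀ ∉ M0 := fun hh => hy.2 (hyF ▸ hFM0 (hFM0 hh))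
  refine ⟨F w₀, hFmap hw0, hyF, ?_⟩
  have t4 : Tendsto (fun k => b (φ k) + ρ (w (φ k)) (F w₀)) atTop (𝓝 0) := by
    simpa using ((sq _ h7).comp tφ).add (hρ.zero_tendsto (fun k => hw (φ k))
      (fun _ => hFmap hw0) hM0cl ⟨hw0, hw1⟩ (hFmap hw0) t1 tendsto_const_nhds)
  rw [rhoLe_iff]
  intro ε hε
  obtain ⟨k, hk⟩ := (t4.eventually (gt_mem_nhds hε)).exists
  exact ⟨_, _, (h1 (φ k)).trans (PChain.single (ρ := ρ) (hw _) (hFmap hw0)), hk⟩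

theorem rhoLe_F (hFmap : MapsTo F M M) (hρ : HypRho F M M0 ρ) (hy : y ∈ M) :
    rhoLe ρ M y (F y) := by
  rw [rhoLe_iff]
  intro ε hε
  exact ⟨0, _, PChain.single hy (hFmap hy), by
    rwa [(hρ.2.1 y hy _ (hFmap hy)).2 rfl]⟩

end aux

theorem stmt14 (d : ℕ) (M M0 : Set (Fin d → ℝ)) (F : (Fin d → ℝ) → Fin d → ℝ)
    (hMcl : IsClosed M) (hM0cl : IsClosed M0) (hM0M : M0 ⊆ M)
    (hFmap : MapsTo F M M) (hFcont : ContinuousOn F M)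
    (hFbdd : ∃ C : ℝ, ∀ x ∈ M, ‖F x‖ ≤ C)
    (hFM0 : MapsTo F M0 M0) (hFM1 : MapsTo F (M \ M0) (M \ M0))
    (ρ : (Fin d → ℝ) → (Fin d → ℝ) → ℝ≥0∞) (hρ : HypRho F M M0 ρ)
    (x : Fin d → ℝ) (hx : x ∈ rhoRec ρ M)
    (hcl : IsClosed (rhoClass ρ M x)) (hsub : rhoClass ρ M x ⊆ M \ M0) :
    F '' rhoClass ρ M x = rhoClass ρ M x := by
  apply Subset.antisymm
  · rintro _ ⟨y, hy, rfl⟩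
    have hyM := hsub hy
    have a := rho_forward hFmap hFcont hM0cl hFM1 hρ hyM hy.1.1
    have b := rhoLe_F hFmap hρ hyM.1
    exact ⟨⟨a.trans' b, a.trans' b⟩, hy.2.1.trans' b, a.trans' hy.2.2⟩
  · intro y hy
    have hyM := hsub hy
    obtain ⟨z, hz, rfl, a⟩ := rho_backward hMcl hFmap hFcont hM0cl hFM0 hFbdd hρ hyM hy.1.1
    have b := rhoLe_F hFmap hρ hz
    exact ⟨z, ⟨⟨b.trans' a, b.trans' a⟩, hy.2.1.trans' a, b.trans' hy.2.2⟩, rfl⟩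

end QSDPaper
end
end

section
/- Assume Hypothesis 2.4 holds for the kernels {p^ε}. Let K ⊆ M be a compact set which contains no entire forward semiorbit {F^i(x) : i ∈ ℕ} of F. Then there exist a > 0 and N ∈ ℕ (depending on K) such that: (a) for any finite sequence ξ = (ξ_0,…,ξ_n) of points of K with n > N, A_n(ξ) > (n − N)a; (b) there exists ε_0 > 0 such that for every n > N and every 0 < ε < ε_0, sup_{x ∈ K} P_x[τ^ε_K > n] ≤ e^{−(n−N)a/ε}, where τ^ε_K = inf{j ≥ 0 : X^ε_j ∉ K}. -/
open MeasureTheory ProbabilityTheory Metric Set Filter Topology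
open scoped ENNReal NNReal

noncomputable section

namespace QSDPaper

variable {d : ℕ}

/-- finite pseudo-orbit in `K` -/
def PO (F : (Fin d → ℝ) → Fin d → ℝ) (K : Set (Fin d → ℝ)) (β : ℝ) (n : ℕ)
    (ξ : ℕ → Fin d → ℝ) : Prop :=
  (∀ i ≤ n, ξ i ∈ K) ∧ ∀ i < n, dist (F (ξ i)) (ξ (i + 1)) ≤ β

lemma exists_noPO (F : (Fin d → ℝ) → Fin d → ℝ) (M K : Set (Fin d → ℝ))
    (hFcont : ContinuousOn F M) (hK : IsCompact K) (hKM : K ⊆ M)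
    (hsemi : ∀ x ∈ K, ∃ i : ℕ, F^[i] x ∉ K) :
    ∃ L : ℕ, 0 < L ∧ ∃ β : ℝ, 0 < β ∧ ∀ ξ, ¬ PO F K β L ξ := by
  by_contra hcon
  push Not at hcon
  have h1 : ∀ k : ℕ, ∃ ξ, PO F K (1 / ((k : ℝ) + 1)) (k + 1) ξ := fun k =>
    hcon (k + 1) (Nat.succ_pos k) _ (by positivity)
  choose ξ hξ using h1
  have hc : IsCompact (Set.pi univ (fun _ : ℕ => K)) := isCompact_univ_pi (fun _ => hK)
  let ζ : ℕ → ℕ → Fin d → ℝ := fun k i => if i ≤ k + 1 then ξ k i else ξ k 0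
  have hζ : ∀ k, ζ k ∈ Set.pi univ (fun _ : ℕ => K) := by
    intro k i _
    simp only [ζ]
    split_ifs with h
    · exact (hξ k).1 i h
    · exact (hξ k).1 0 (Nat.zero_le _)
  obtain ⟨z, hz, φ, hφ, hlim⟩ := hc.tendsto_subseq hζ
  rw [tendsto_pi_nhds] at hlim
  have hzK : ∀ i, z i ∈ K := fun i => hz i (mem_univ i)
  have horb : ∀ i, z (i + 1) = F (z i) := by
    intro i
    have h2 : Tendsto (fun k => F (ζ (φ k) i)) atTop (𝓝 (F (z i))) := by
      have := (hFcont (z i) (hKM (hzK i)))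
      refine this.tendsto.comp ?_
      refine tendsto_nhdsWithin_iff.2 ⟨hlim i, ?_⟩
      exact Eventually.of_forall (fun k => hKM (hζ (φ k) i (mem_univ i)))
    have h3 := h2.dist (hlim (i + 1))
    have h4 : Tendsto (fun k => 1 / (((φ k : ℕ) : ℝ) + 1)) atTop (𝓝 0) :=
      tendsto_one_div_add_atTop_nhds_zero_nat.comp hφ.tendsto_atTop
    have h5 : dist (F (z i)) (z (i + 1)) ≤ 0 := by
      refine le_of_tendsto_of_tendsto h3 h4 ?_
      filter_upwards [eventually_ge_atTop i] with k hk
      have hk' : i ≤ φ k := hk.trans hφ.le_apply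
      have := (hξ (φ k)).2 i (by omega)
      simp only [ζ, Function.comp]
      rw [if_pos (by omega), if_pos (by omega)]
      exact this
    exact (dist_le_zero.1 h5).symm
  have hit : ∀ i, F^[i] (z 0) = z i := by
    intro i
    induction i with
    | zero => rfl
    | succ i ih => rw [Function.iterate_succ_apply', ih, horb]
  obtain ⟨i, hi⟩ := hsemi (z 0) (hzK 0)
  rw [hit] at hi
  exact hi (hzK i)

lemma cost_block (F : (Fin d → ℝ) → Fin d → ℝ) (K : Set (Fin d → ℝ)) (β : ℝ) (L : ℕ)
    (hno : ∀ ξ, ¬ PO F K β L ξ) (ρ : (Fin d → ℝ) → (Fin d → ℝ) → ℝ≥0∞) (c : ℝ≥0∞)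
    (hc : ∀ x ∈ K, ∀ y ∈ K, β < dist (F x) y → c ≤ ρ x y) (q : ℕ) :
    ∀ n, q * L ≤ n → ∀ ξ : ℕ → Fin d → ℝ, (∀ i ≤ n, ξ i ∈ K) → q * c ≤ rhoCost ρ n ξ := by
  induction q with
  | zero => intro n _ ξ _; simp
  | succ q ih =>
    intro n hn ξ hξ
    have hn' : L + q * L ≤ n := by rw [Nat.succ_mul] at hn; omega
    obtain ⟨m, rfl⟩ : ∃ m, n = L + m := ⟨n - L, by omega⟩
    have h1 := ih m (by omega) (fun i => ξ (L + i)) (fun i hi => hξ _ (by omega))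
    have h2 : c ≤ rhoCost ρ L ξ := by
      have := hno ξ
      unfold PO at this
      push Not at this
      obtain ⟨i, hi, hd⟩ := this (fun i hi => hξ i (by omega))
      refine (hc _ (hξ i (by omega)) _ (hξ (i + 1) (by omega)) hd).trans ?_
      exact Finset.single_le_sum (f := fun i => ρ (ξ i) (ξ (i + 1)))
        (fun _ _ => zero_le) (Finset.mem_range.2 hi)
    have h3 : rhoCost ρ (L + m) ξ = rhoCost ρ L ξ + rhoCost ρ m (fun i => ξ (L + i)) := by
      unfold rhoCost
      rw [Finset.sum_range_add]
      rfl
    rw [h3]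
    push_cast
    rw [add_mul, one_mul, add_comm]
    exact add_le_add h2 h1

lemma stay_le_one (κ : Kernel (Fin d → ℝ) (Fin d → ℝ)) [IsMarkovKernel κ]
    (K : Set (Fin d → ℝ)) (n : ℕ) : ∀ x, stayProb κ K n x ≤ K.indicator 1 x := by
  induction n with
  | zero => intro x; exact le_rfl
  | succ n ih =>
    intro x
    simp only [stayProb]
    apply Set.indicator_le_indicator
    calc ∫⁻ y, stayProb κ K n y ∂κ x ≤ ∫⁻ _, 1 ∂κ x :=
          lintegral_mono (fun y => (ih y).trans (Set.indicator_le_self' (by simp) y))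
      _ = 1 := by simp

lemma stay_mul (κ : Kernel (Fin d → ℝ) (Fin d → ℝ)) [IsMarkovKernel κ]
    (K : Set (Fin d → ℝ)) (L : ℕ) (b : ℝ≥0∞) (hb : b ≠ ⊤)
    (h : ∀ x, stayProb κ K L x ≤ b) (m : ℕ) :
    ∀ x, stayProb κ K (m + L) x ≤ b * stayProb κ K m x := by
  induction m with
  | zero =>
    intro x
    by_cases hx : x ∈ K
    · simpa [stayProb, hx] using h x
    · have := stay_le_one κ K (0 + L) x
      simp only [Set.indicator_of_notMem hx] at this
      exact this.trans zero_le
  | succ m ih =>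
    intro x
    rw [show m + 1 + L = (m + L) + 1 by omega]
    by_cases hx : x ∈ K
    · simp only [stayProb, Set.indicator_of_mem hx]
      rw [← lintegral_const_mul' _ _ hb]
      exact lintegral_mono ih
    · simp [stayProb, hx]

lemma stay_pow (κ : Kernel (Fin d → ℝ) (Fin d → ℝ)) [IsMarkovKernel κ]
    (K : Set (Fin d → ℝ)) (L : ℕ) (b : ℝ≥0∞) (hb : b ≠ ⊤)
    (h : ∀ x, stayProb κ K L x ≤ b) (r q : ℕ) :
    ∀ x, stayProb κ K (r + q * L) x ≤ b ^ q := by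
  induction q with
  | zero =>
    intro x
    simpa using (stay_le_one κ K r x).trans (Set.indicator_le_self' (by simp) x)
  | succ q ih =>
    intro x
    rw [show r + (q + 1) * L = (r + q * L) + L by ring]
    refine (stay_mul κ K L b hb h _ x).trans ?_
    rw [pow_succ, mul_comm]
    gcongr
    exact ih x

lemma stay_block (κ : Kernel (Fin d → ℝ) (Fin d → ℝ)) [IsMarkovKernel κ]
    (F : (Fin d → ℝ) → Fin d → ℝ) (K : Set (Fin d → ℝ)) (hK : IsClosed K) (β : ℝ) (b : ℝ≥0∞)
    (hb : ∀ x ∈ K, κ x {y | y ∈ K ∧ β < dist (F x) y} ≤ b) (m : ℕ) :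
    ∀ x, (∀ ξ, ξ 0 = x → ¬ PO F K β m ξ) → stayProb κ K m x ≤ m * b := by
  induction m with
  | zero =>
    intro x hx
    have : x ∉ K := fun h => hx (fun _ => x) rfl ⟨fun _ _ => h, fun i hi => by omega⟩
    simp [stayProb, this]
  | succ m ih =>
    intro x hx
    by_cases hxK : x ∈ K
    swap
    · simp [stayProb, hxK]
    simp only [stayProb, Set.indicator_of_mem hxK]
    set B := {y | y ∈ K ∧ β < dist (F x) y} with hB
    have hBm : MeasurableSet B :=
      hK.measurableSet.inter (isOpen_lt (f := fun _ => β) (g := fun y => dist (F x) y)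
        continuous_const (continuous_const.dist continuous_id)).measurableSet
    have key : ∀ y, stayProb κ K m y ≤ m * b + B.indicator 1 y := by
      intro y
      by_cases hyK : y ∈ K
      · by_cases hd : β < dist (F x) y
        · have : y ∈ B := ⟨hyK, hd⟩
          rw [Set.indicator_of_mem this]
          refine le_add_left ?_
          simpa [hyK] using stay_le_one κ K m y
        · refine le_add_right (ih y ?_)
          intro ξ h0 hP
          refine hx (fun i => Nat.casesOn i x ξ) rfl ⟨?_, ?_⟩
          · intro i hi
            cases i with
            | zero => exact hxK
            | succ i => exact hP.1 i (by omega)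
          · intro i hi
            cases i with
            | zero => simpa [h0] using hd
            | succ i => exact hP.2 i (by omega)
      · have := stay_le_one κ K m y
        simp only [Set.indicator_of_notMem hyK] at this
        exact this.trans zero_le
    calc ∫⁻ y, stayProb κ K m y ∂κ x ≤ ∫⁻ y, (m * b + B.indicator 1 y) ∂κ x := lintegral_mono key
      _ = m * b + κ x B := by
        rw [lintegral_add_left measurable_const, lintegral_indicator_one hBm]; simp
      _ ≤ m * b + b := by gcongr; exact hb x hxK
      _ = (m + 1 : ℕ) * b := by push_cast; ring

lemma ld_aux (ε c η : ℝ) (hε : 0 < ε) (P : ℝ≥0∞) (I : ℝ≥0∞) (hI : ENNReal.ofReal c ≤ I) (hc : 0 < c)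
    (h : (ε : EReal) * ENNReal.log P + (I : EReal) ≤ (η : EReal)) :
    P ≤ ENNReal.ofReal (Real.exp (-(c - η) / ε)) := by
  have h1 : (ε : EReal) * ENNReal.log P + (c : EReal) ≤ (η : EReal) := by
    refine le_trans ?_ h
    gcongr
    have : ((ENNReal.ofReal c : ℝ≥0∞) : EReal) ≤ I := by exact_mod_cast hI
    rwa [EReal.coe_ennreal_ofReal, max_eq_left hc.le] at this
  rw [← ENNReal.log_le_log_iff]
  have h2 : ENNReal.log (ENNReal.ofReal (Real.exp (-(c - η) / ε)))
      = ((-(c - η) / ε : ℝ) : EReal) := by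
    rw [ENNReal.log_ofReal_of_pos (Real.exp_pos _), Real.log_exp]
  rw [h2]
  induction hl : ENNReal.log P with
  | bot => exact bot_le
  | top =>
    rw [hl, EReal.coe_mul_top_of_pos hε] at h1
    simp at h1
  | coe r =>
    rw [hl] at h1
    have h3 : ε * r + c ≤ η := by exact_mod_cast h1
    rw [EReal.coe_le_coe_iff, le_div_iff₀ hε]
    linarith

theorem stmt16 (d : ℕ) (M M0 : Set (Fin d → ℝ)) (F : (Fin d → ℝ) → Fin d → ℝ)
    (hMcl : IsClosed M) (hM0cl : IsClosed M0) (hM0M : M0 ⊆ M)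
    (hFmap : MapsTo F M M) (hFcont : ContinuousOn F M)
    (hFbdd : ∃ C : ℝ, ∀ x ∈ M, ‖F x‖ ≤ C)
    (hFM0 : MapsTo F M0 M0) (hFM1 : MapsTo F (M \ M0) (M \ M0))
    (p : ℝ → Kernel (Fin d → ℝ) (Fin d → ℝ))
    (hp : ∀ ε > (0 : ℝ), IsMarkovKernel (p ε))
    (habs : ∀ ε > (0 : ℝ), ∀ x ∈ M0, p ε x (M \ M0) = 0)
    (ρ : (Fin d → ℝ) → (Fin d → ℝ) → ℝ≥0∞)
    (hρ : HypRho F M M0 ρ) (hLD : HypLD p F M M0 ρ)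
    (K : Set (Fin d → ℝ)) (hK : IsCompact K) (hKM : K ⊆ M)
    (hsemi : ∀ x ∈ K, ∃ i : ℕ, F^[i] x ∉ K) :
    ∃ a > (0 : ℝ), ∃ N : ℕ,
      (∀ n : ℕ, N < n → ∀ ξ : ℕ → Fin d → ℝ, (∀ i ≤ n, ξ i ∈ K) →
        ENNReal.ofReal (((n : ℝ) - N) * a) < rhoCost ρ n ξ) ∧
      ∃ ε₀ > (0 : ℝ), ∀ n : ℕ, N < n → ∀ ε, 0 < ε → ε < ε₀ → ∀ x ∈ K,
        stayProb (p ε) K n x ≤ ENNReal.ofReal (Real.exp (-(((n : ℝ) - N) * a) / ε)) := by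
  obtain ⟨L, hL, β, hβ, hno⟩ := exists_noPO F M K hFcont hK hKM hsemi
  obtain ⟨c', hc', hcρ⟩ := hρ.2.2 (β / 2) (by positivity)
  obtain ⟨c, hc, hcc⟩ : ∃ c : ℝ, 0 < c ∧ ENNReal.ofReal c ≤ c' := by
    refine ⟨(min c' 1).toReal, ENNReal.toReal_pos (by simp [hc'.ne']) (by simp), ?_⟩
    rw [ENNReal.ofReal_toReal (by simp)]
    exact min_le_left _ _
  have hLr : (0 : ℝ) < L := by exact_mod_cast hL
  have hq : ∀ n : ℕ, ((n : ℝ) - L) / L < ((n / L : ℕ) : ℝ) := by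
    intro n
    rw [div_lt_iff₀ hLr]
    have h1 := Nat.lt_div_mul_add (a := n) hL
    have : (n : ℝ) < (n / L : ℕ) * L + L := by exact_mod_cast h1
    linarith
  refine ⟨c / 4 / L, by positivity, L, ?_, ?_⟩
  · intro n hn ξ hξ
    have h1 := cost_block F K β L hno ρ (ENNReal.ofReal c)
      (fun x hx y hy hd => hcc.trans (hcρ x (hKM hx) y (hKM hy) (by linarith)))
      (n / L) n (Nat.div_mul_le_self n L) ξ hξ
    refine lt_of_lt_of_le ?_ h1
    rw [← ENNReal.ofReal_natCast, ← ENNReal.ofReal_mul (by positivity)]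
    have hnq : (1 : ℝ) ≤ ((n / L : ℕ) : ℝ) := by
      exact_mod_cast (Nat.div_pos hn.le hL)
    rw [ENNReal.ofReal_lt_ofReal_iff (by positivity)]
    have h2 := hq n
    calc ((n : ℝ) - L) * (c / 4 / L) = ((n : ℝ) - L) / L * (c / 4) := by ring
      _ < ((n / L : ℕ) : ℝ) * (c / 4) := by gcongr
      _ ≤ ((n / L : ℕ) : ℝ) * c := by gcongr; linarith
  · obtain ⟨T, hTK, hTfin, hcov⟩ := hK.finite_cover_balls (e := β / 4) (by positivity)
    lift T to Finset (Fin d → ℝ) using hTfin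
    have hev1 : ∀ᶠ ε : ℝ in 𝓝[>] (0 : ℝ), ∀ t ∈ T, ∀ x ∈ M,
        (ε : EReal) * ENNReal.log (p ε x (closedBall t (β / 4) ∩ K)) +
          ((⨅ y ∈ closedBall t (β / 4) ∩ K, ρ x y : ℝ≥0∞) : EReal) ≤ ((c / 2 : ℝ) : EReal) := by
      rw [Filter.eventually_all_finset]
      intro t _
      exact hLD.2 _ (isClosed_closedBall.inter hK.isClosed) (inter_subset_right.trans hKM)
        (c / 2) (by positivity)
    have hev2 : ∀ᶠ ε : ℝ in 𝓝[>] (0 : ℝ), (L : ℝ) * T.card ≤ Real.exp (c / 4 / ε) := by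
      have : Tendsto (fun ε : ℝ => Real.exp (c / 4 / ε)) (𝓝[>] 0) atTop := by
        refine Real.tendsto_exp_atTop.comp ?_
        have h := (tendsto_inv_nhdsGT_zero (𝕜 := ℝ)).const_mul_atTop
          (show (0 : ℝ) < c / 4 by positivity)
        exact h.congr (fun ε => (div_eq_mul_inv _ _).symm)
      exact this.eventually_ge_atTop _
    obtain ⟨ε₀, hε₀, hsub⟩ := mem_nhdsGT_iff_exists_Ioo_subset.1 (hev1.and hev2)
    refine ⟨ε₀, hε₀, ?_⟩
    intro n hn ε hε hεl x hx
    obtain ⟨h1, h2⟩ := hsub ⟨hε, hεl⟩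
    haveI := hp ε hε
    set E : ℝ≥0∞ := ENNReal.ofReal (Real.exp (-(c - c / 2) / ε)) with hE
    have hbad : ∀ x ∈ K, p ε x {y | y ∈ K ∧ β < dist (F x) y} ≤ T.card * E := by
      intro x hx
      classical
      let T' := T.filter (fun t => β * (3 / 4) < dist (F x) t)
      have hsub' : {y | y ∈ K ∧ β < dist (F x) y} ⊆ ⋃ t ∈ T', closedBall t (β / 4) ∩ K := by
        rintro y ⟨hyK, hd⟩
        obtain ⟨t, ht, hyt⟩ := mem_iUnion₂.1 (hcov hyK)
        refine mem_iUnion₂.2 ⟨t, ?_, ball_subset_closedBall hyt, hyK⟩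
        refine Finset.mem_filter.2 ⟨ht, ?_⟩
        have := dist_triangle (F x) t y
        rw [mem_ball, dist_comm] at hyt
        linarith
      calc p ε x {y | y ∈ K ∧ β < dist (F x) y}
          ≤ p ε x (⋃ t ∈ T', closedBall t (β / 4) ∩ K) := measure_mono hsub'
        _ ≤ ∑ t ∈ T', p ε x (closedBall t (β / 4) ∩ K) := measure_biUnion_finset_le _ _
        _ ≤ ∑ t ∈ T', E := by
          refine Finset.sum_le_sum (fun t ht => ?_)
          obtain ⟨htT, htd⟩ := Finset.mem_filter.1 ht
          refine ld_aux ε c (c / 2) hε _ _ ?_ hc (h1 t htT x (hKM hx))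
          refine le_iInf₂ (fun y hy => hcc.trans (hcρ x (hKM hx) y (hKM hy.2) ?_))
          have := dist_triangle (F x) y t
          have h3 := mem_closedBall.1 hy.1
          linarith
        _ = T'.card * E := by simp
        _ ≤ T.card * E := by
          gcongr
          exact Finset.filter_subset _ _
    have hblock : ∀ x, stayProb (p ε) K L x ≤ ENNReal.ofReal (Real.exp (-(c / 4) / ε)) := by
      intro x
      refine (stay_block (p ε) F K hK.isClosed β _ hbad L x (fun ξ _ => hno ξ)).trans ?_
      rw [hE, ← mul_assoc, ← ENNReal.ofReal_natCast, ← ENNReal.ofReal_natCast,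
        ← ENNReal.ofReal_mul (by positivity), ← ENNReal.ofReal_mul (by positivity)]
      apply ENNReal.ofReal_le_ofReal
      calc (L : ℝ) * T.card * Real.exp (-(c - c / 2) / ε)
          ≤ Real.exp (c / 4 / ε) * Real.exp (-(c - c / 2) / ε) := by gcongr
        _ = Real.exp (-(c / 4) / ε) := by rw [← Real.exp_add]; congr 1; ring
    have h3 := stay_pow (p ε) K L _ ENNReal.ofReal_ne_top hblock (n % L) (n / L) x
    rw [Nat.mod_add_div'] at h3
    refine h3.trans ?_
    rw [← ENNReal.ofReal_pow (Real.exp_pos _).le, ← Real.exp_nat_mul]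
    apply ENNReal.ofReal_le_ofReal
    apply Real.exp_le_exp.2
    have h4 := hq n
    calc ((n / L : ℕ) : ℝ) * (-(c / 4) / ε) = -(((n / L : ℕ) : ℝ) * (c / 4 / ε)) := by ring
      _ ≤ -(((n : ℝ) - L) / L * (c / 4 / ε)) := by
        have : (0:ℝ) ≤ c / 4 / ε := by positivity
        have := mul_le_mul_of_nonneg_right h4.le this
        linarith
      _ = -(((n : ℝ) - L) * (c / 4 / L)) / ε := by ring

end QSDPaper
end
end

section
/- Let ρ satisfy properties (i)–(iii) of Hypothesis 2.4. Then the set of nonwandering points of F intersected with M_1 is contained in the ρ-chain recurrent set: NW(F) ∩ M_1 ⊆ R_ρ. In particular, any ω-limit point of F lying in M_1 belongs to R_ρ. -/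
open MeasureTheory ProbabilityTheory Metric Set Filter Topology
open scoped ENNReal NNReal

noncomputable section

namespace QSDPaper

variable {d : ℕ}

theorem Brho_le_aux {d : ℕ} {M M0 : Set (Fin d → ℝ)} {F : (Fin d → ℝ) → Fin d → ℝ}
    (hFmap : MapsTo F M M)
    {ρ : (Fin d → ℝ) → (Fin d → ℝ) → ℝ≥0∞} (hρ : HypRho F M M0 ρ)
    {x z : Fin d → ℝ} (hx : x ∈ M) (hz : z ∈ M) (m : ℕ) :
    Brho ρ M x x ≤ ρ x (F z) + ρ (F^[m+1] z) x := by
  have hit : ∀ i, F^[i] z ∈ M := fun i => hFmap.iterate i hz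
  let ξ : ℕ → Fin d → ℝ := fun i => if i = 0 ∨ i = m + 2 then x else F^[i] z
  have h1 : Brho ρ M x x ≤ rhoCost ρ (m+2) ξ := by
    unfold Brho
    refine iInf_le_of_le (m+2) (iInf_le_of_le (by omega) (iInf_le_of_le ξ (iInf_le_of_le ?_ le_rfl)))
    refine ⟨fun i _ => ?_, by simp [ξ], by simp [ξ]⟩
    simp only [ξ]
    split_ifs
    · exact hx
    · exact hit i
  refine h1.trans (le_of_eq ?_)
  unfold rhoCost
  rw [Finset.sum_range_succ, Finset.sum_range_succ']
  have h2 : ∑ k ∈ Finset.range m, ρ (ξ (k+1)) (ξ (k+1+1)) = 0 := by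
    refine Finset.sum_eq_zero fun k hk => ?_
    have hk' := Finset.mem_range.1 hk
    have e1 : ξ (k+1) = F^[k+1] z := if_neg (by omega)
    have e2 : ξ (k+1+1) = F^[k+1+1] z := if_neg (by omega)
    rw [e1, e2, hρ.2.1 _ (hit _) _ (hit _), Function.iterate_succ_apply']
  have e0 : ξ 0 = x := if_pos (by omega)
  have e1 : ξ (0+1) = F z := if_neg (by omega)
  have e2 : ξ (m+1) = F^[m+1] z := if_neg (by omega)
  have e3 : ξ (m+1+1) = x := if_pos (by omega)
  rw [h2, e0, e1, e2, e3, zero_add]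

theorem stmt17 (d : ℕ) (M M0 : Set (Fin d → ℝ)) (F : (Fin d → ℝ) → Fin d → ℝ)
    (hMcl : IsClosed M) (hM0cl : IsClosed M0) (hM0M : M0 ⊆ M)
    (hFmap : MapsTo F M M) (hFcont : ContinuousOn F M)
    (hFbdd : ∃ C : ℝ, ∀ x ∈ M, ‖F x‖ ≤ C)
    (hFM0 : MapsTo F M0 M0) (hFM1 : MapsTo F (M \ M0) (M \ M0))
    (ρ : (Fin d → ℝ) → (Fin d → ℝ) → ℝ≥0∞) (hρ : HypRho F M M0 ρ) :
    nonwanderingSet F M ∩ (M \ M0) ⊆ rhoRec ρ M ∧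
    ∀ x ∈ M, ∀ y ∈ omegaSet F x, y ∈ M \ M0 → y ∈ rhoRec ρ M := by
  have key : nonwanderingSet F M ∩ (M \ M0) ⊆ rhoRec ρ M := by
    rintro x ⟨⟨hxM, hnw⟩, hx1⟩
    have hz : ∀ k : ℕ, ∃ z ∈ M, ∃ m : ℕ, dist z x < 1 / ((k:ℝ)+1) ∧
        dist (F^[m+2] z) x < 1 / ((k:ℝ)+1) := by
      intro k
      obtain ⟨n, hn, y, ⟨z, ⟨hzU, hzM⟩, rfl⟩, hyU, -⟩ :=
        hnw (ball x (1 / ((k:ℝ)+1))) isOpen_ball (mem_ball_self (by positivity)) 2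
      obtain ⟨m, rfl⟩ := Nat.exists_eq_add_of_le' hn
      exact ⟨z, hzM, m, hzU, hyU⟩
    choose z hzM m hd1 hd2 using hz
    have hlim := tendsto_one_div_add_atTop_nhds_zero_nat (𝕜 := ℝ)
    have hzx : Tendsto z atTop (𝓝 x) :=
      tendsto_iff_dist_tendsto_zero.2 (squeeze_zero (fun _ => dist_nonneg) (fun k => (hd1 k).le) hlim)
    have hFx : Tendsto (fun k => F^[m k + 2] (z k)) atTop (𝓝 x) :=
      tendsto_iff_dist_tendsto_zero.2 (squeeze_zero (fun _ => dist_nonneg) (fun k => (hd2 k).le) hlim)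
    let w : ℕ → Fin d → ℝ := fun k => F^[m k + 1] (z k)
    have hwM : ∀ k, w k ∈ M := fun k => hFmap.iterate _ (hzM k)
    have hFw : Tendsto (fun k => F (w k)) atTop (𝓝 x) := by
      refine hFx.congr fun k => ?_
      exact Function.iterate_succ_apply' F (m k + 1) (z k)
    obtain ⟨C, hC⟩ := hFbdd
    have hwb : ∀ k, w k ∈ closedBall (0 : Fin d → ℝ) C := fun k => by
      rw [mem_closedBall_zero_iff]
      have : w k = F (F^[m k] (z k)) := Function.iterate_succ_apply' F (m k) (z k)
      rw [this]
      exact hC _ (hFmap.iterate _ (hzM k))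
    obtain ⟨a, -, φ, hφ, hwa⟩ := (isCompact_closedBall (0 : Fin d → ℝ) C).tendsto_subseq hwb
    have haM : a ∈ M := hMcl.mem_of_tendsto hwa (Eventually.of_forall fun k => hwM _)
    have hwa' : Tendsto (w ∘ φ) atTop (𝓝[M] a) :=
      tendsto_nhdsWithin_iff.2 ⟨hwa, Eventually.of_forall fun k => hwM _⟩
    have hFa : F a = x :=
      tendsto_nhds_unique ((hFcont a haM).tendsto.comp hwa') (hFw.comp hφ.tendsto_atTop)
    have ha1 : a ∈ M \ M0 := ⟨haM, fun h => hx1.2 (hFa ▸ hFM0 h)⟩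
    have hFz : Tendsto (fun k => F (z (φ k))) atTop (𝓝 (F x)) :=
      (hFcont x hxM).tendsto.comp (tendsto_nhdsWithin_iff.2
        ⟨hzx.comp hφ.tendsto_atTop, Eventually.of_forall fun k => hzM _⟩)
    have t1 : Tendsto (fun k => ρ x (F (z (φ k)))) atTop (𝓝 0) := by
      have h := (hρ.1 (x, F x) ⟨hx1, hFmap hxM⟩).tendsto
      simp only [(hρ.2.1 x hxM (F x) (hFmap hxM)).2 rfl] at h
      exact h.comp (tendsto_nhdsWithin_iff.2 ⟨tendsto_const_nhds.prodMk_nhds hFz,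
        Eventually.of_forall fun k => ⟨hx1, hFmap (hzM _)⟩⟩)
    have hev : ∀ᶠ k in atTop, (w ∘ φ) k ∈ M0ᶜ :=
      hwa.eventually (hM0cl.isOpen_compl.mem_nhds ha1.2)
    have t2 : Tendsto (fun k => ρ (w (φ k)) x) atTop (𝓝 0) := by
      have h := (hρ.1 (a, x) ⟨ha1, hxM⟩).tendsto
      simp only [(hρ.2.1 a haM x hxM).2 hFa.symm] at h
      refine h.comp (tendsto_nhdsWithin_iff.2 ⟨hwa.prodMk_nhds tendsto_const_nhds, ?_⟩)
      filter_upwards [hev] with k hk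
      exact ⟨⟨hwM _, hk⟩, hxM⟩
    have hB : Brho ρ M x x ≤ 0 := by
      have h := t1.add t2
      rw [add_zero] at h
      exact ge_of_tendsto' h fun k => Brho_le_aux hFmap hρ hxM (hzM _) (m (φ k))
    have hB0 : Brho ρ M x x = 0 := le_antisymm hB bot_le
    exact ⟨hB0, hB0⟩
  refine ⟨key, ?_⟩
  rintro x hx y ⟨φ, hφ, hy⟩ hy1
  refine key ⟨⟨hy1.1, fun U hU hyU N => ?_⟩, hy1⟩
  obtain ⟨K, hK⟩ := eventually_atTop.1 (hy.eventually (hU.mem_nhds hyU))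
  have hge := hφ.le_apply (x := K + (φ K + N))
  have hM : ∀ i, F^[i] x ∈ M := fun i => hFmap.iterate i hx
  refine ⟨φ (K + (φ K + N)) - φ K, by omega, F^[φ (K + (φ K + N))] x,
    ⟨F^[φ K] x, ⟨hK K le_rfl, hM _⟩, ?_⟩, hK _ (by omega), hM _⟩
  rw [← Function.iterate_add_apply]
  congr 2
  omega

end QSDPaper
end
end

section
/- Let ρ satisfy properties (i)–(iii) of Hypothesis 2.4. If μ is an F-invariant Borel probability measure on M (μ(F^{-1}(Γ)) = μ(Γ) for all Borel Γ) whose support S lies in M_1, then S ⊆ R_ρ. -/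
open MeasureTheory ProbabilityTheory Metric Set Filter Topology
open scoped ENNReal NNReal

noncomputable section

namespace QSDPaper

variable {d : ℕ}

theorem stmt18 (d : ℕ) (M M0 : Set (Fin d → ℝ)) (F : (Fin d → ℝ) → Fin d → ℝ)
    (hMcl : IsClosed M) (hM0cl : IsClosed M0) (hM0M : M0 ⊆ M)
    (hFmap : MapsTo F M M) (hFcont : ContinuousOn F M)
    (hFbdd : ∃ C : ℝ, ∀ x ∈ M, ‖F x‖ ≤ C)
    (hFM0 : MapsTo F M0 M0) (hFM1 : MapsTo F (M \ M0) (M \ M0))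
    (ρ : (Fin d → ℝ) → (Fin d → ℝ) → ℝ≥0∞) (hρ : HypRho F M M0 ρ)
    (μ : Measure (Fin d → ℝ)) (hprob : IsProbabilityMeasure μ) (hμM : μ M = 1)
    (hinv : ∀ Γ : Set (Fin d → ℝ), MeasurableSet Γ → μ (F ⁻¹' Γ) = μ Γ)
    (hsupp : measSupport μ ⊆ M \ M0) :
    measSupport μ ⊆ rhoRec ρ M := by
  classical
  obtain ⟨hρc, hρ0, -⟩ := hρ
  have hSeq : measSupport μ = μ.support := by
    rw [Measure.support_eq_forall_isOpen]
    ext x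
    exact ⟨fun h U hx hU => h U hU hx, fun h U hU hx => h U hx hU⟩
  have hSM : measSupport μ ⊆ M := fun z hz => (hsupp hz).1
  have hSae : ∀ᵐ y ∂μ, y ∈ measSupport μ := by
    rw [hSeq]; exact Measure.support_mem_ae
  have hMae : ∀ᵐ y ∂μ, y ∈ M := hSae.mono fun y hy => hSM hy
  obtain ⟨C, hC⟩ := hFbdd
  -- the support is compact
  have hScomp : IsCompact (measSupport μ) := by
    refine (isCompact_closedBall (0 : Fin d → ℝ) C).of_isClosed_subset
      (by rw [hSeq]; exact Measure.isClosed_support) ?_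
    rw [hSeq]
    refine Measure.support_subset_of_isClosed isClosed_closedBall ?_
    rw [mem_ae_iff, ← hinv _ isClosed_closedBall.measurableSet.compl]
    refine measure_mono_null (t := Mᶜ) ?_ hMae
    intro y hy hyM
    exact hy (by simpa using hC y hyM)
  -- a measurable version of the map
  set G : (Fin d → ℝ) → Fin d → ℝ := M.piecewise F id with hG
  have hGM : ∀ y ∈ M, G y = F y := fun y hy => by simp [hG, hy]
  have hGmeas : Measurable G :=
    hFcont.measurable_piecewise continuous_id.continuousOn hMcl.measurableSet
  have hGF : G =ᵐ[μ] F := hMae.mono fun y hy => hGM y hy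
  have hGpres : MeasurePreserving G μ μ := by
    refine ⟨hGmeas, ?_⟩
    ext Γ hΓ
    rw [Measure.map_apply hGmeas hΓ, ← hinv Γ hΓ]
    refine measure_congr ?_
    filter_upwards [hGF] with y hy
    exact congrArg (fun w => w ∈ Γ) hy
  have horb : ∀ᵐ y ∂μ, ∀ n, G^[n] y ∈ measSupport μ := by
    rw [ae_all_iff]
    intro n
    exact (hGpres.iterate n).quasiMeasurePreserving.ae hSae
  intro x hx
  have hxM := hsupp hx
  suffices h : Brho ρ M x x = 0 from ⟨h, h⟩
  refine le_antisymm (le_of_forall_pos_le_add fun ε hε => ?_) bot_le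
  rw [zero_add]
  have hε2 : 0 < ε / 2 := ENNReal.half_pos hε.ne'
  -- first condition
  have h1 : ∀ᶠ w in 𝓝[M] x, ρ x (F w) < ε / 2 := by
    have hc : ContinuousOn (fun w => ρ x (F w)) M :=
      hρc.comp (f := fun w => (x, F w)) (continuousOn_const.prodMk hFcont)
        fun w hw => ⟨hxM, hFmap hw⟩
    refine (hc x hxM.1).eventually (gt_mem_nhds ?_)
    simpa only [(hρ0 x hxM.1 _ (hFmap hxM.1)).2 rfl] using hε2
  -- second condition
  have h2 : ∀ᶠ w in 𝓝 x, ∀ z ∈ measSupport μ, F z = w → ρ z x < ε / 2 := by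
    have hc : ContinuousOn (fun z => ρ z x) (measSupport μ) :=
      hρc.comp (f := fun z => (z, x)) (continuousOn_id.prodMk continuousOn_const)
        fun w hw => ⟨hsupp hw, hxM.1⟩
    have hK : IsCompact (measSupport μ ∩ (fun z => ρ z x) ⁻¹' Ici (ε / 2)) :=
      hScomp.of_isClosed_subset (hc.preimage_isClosed_of_isClosed hScomp.isClosed isClosed_Ici)
        inter_subset_left
    have hFK := (hK.image_of_continuousOn
      (hFcont.mono (inter_subset_left.trans hSM))).isClosed
    have hxn : x ∉ F '' (measSupport μ ∩ (fun z => ρ z x) ⁻¹' Ici (ε / 2)) := by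
      rintro ⟨z, ⟨hzS, hz⟩, hzx⟩
      have h0 := (hρ0 z (hSM hzS) x hxM.1).2 hzx.symm
      simp only [mem_preimage, mem_Ici, h0] at hz
      exact absurd hε2 (not_lt.2 hz)
    filter_upwards [hFK.isOpen_compl.mem_nhds hxn] with w hw z hz hzw
    by_contra hcon
    exact hw ⟨z, ⟨hz, not_lt.1 hcon⟩, hzw⟩
  rw [eventually_nhdsWithin_iff] at h1
  obtain ⟨V, hV, hVo, hxV⟩ := _root_.eventually_nhds_iff.1 (h1.and h2)
  have hVpos : μ V ≠ 0 := (hx V hVo hxV).ne'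
  obtain ⟨y, ⟨hyV, hfr⟩, hyS⟩ :=
    ((hGpres.conservative.frequently_ae_mem_and_frequently_image_mem
      hVo.measurableSet.nullMeasurableSet hVpos).and_eventually horb).exists
  obtain ⟨n, hn, hnV⟩ := frequently_atTop.1 hfr 2
  obtain ⟨m, rfl⟩ : ∃ m, n = m + 2 := ⟨n - 2, by omega⟩
  have hstep : ∀ i, G^[i + 1] y = F (G^[i] y) := fun i => by
    rw [Function.iterate_succ_apply', hGM _ (hSM (hyS i))]
  have hyM : y ∈ M := hSM (hyS 0)
  set ξ : ℕ → Fin d → ℝ := fun i => if i = 0 ∨ i = m + 2 then x else G^[i] y with hξ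
  have hmid : ∀ i, i < m + 1 → ξ (i + 1) = G^[i + 1] y := fun i hi => by
    simp only [hξ]; rw [if_neg (by omega)]
  have hξ0 : ξ 0 = x := by simp [hξ]
  have hξn : ξ (m + 2) = x := by simp [hξ]
  have hle : Brho ρ M x x ≤ rhoCost ρ (m + 2) ξ := by
    refine iInf₂_le_of_le (m + 2) (by omega) (iInf₂_le_of_le ξ ⟨?_, hξ0, hξn⟩ le_rfl)
    intro i _
    simp only [hξ]
    split_ifs
    · exact hxM.1
    · exact hSM (hyS i)
  refine hle.trans ?_
  unfold rhoCost
  rw [Finset.sum_range_succ, Finset.sum_range_succ']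
  have hz : ∑ k ∈ Finset.range m, ρ (ξ (k + 1)) (ξ (k + 1 + 1)) = 0 := by
    refine Finset.sum_eq_zero fun k hk => ?_
    have hk := Finset.mem_range.1 hk
    rw [hmid k (by omega), hmid (k + 1) (by omega), hρ0 _ (hSM (hyS _)) _ (hSM (hyS _))]
    exact hstep _
  have ha : ρ (ξ 0) (ξ (0 + 1)) ≤ ε / 2 := by
    rw [hξ0, hmid 0 (by omega), hstep 0]
    exact ((hV y hyV).1 hyM).le
  have hb : ρ (ξ (m + 1)) (ξ (m + 1 + 1)) ≤ ε / 2 := by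
    rw [hmid m (by omega)]
    have := (hV _ hnV).2 (G^[m + 1] y) (hyS _) (hstep _).symm
    rw [show ξ (m + 1 + 1) = x from hξn]
    exact this.le
  rw [hz, zero_add]
  exact (add_le_add ha hb).trans (ENNReal.add_halves ε).le

end QSDPaper
end
end
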